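/- For any probability vector p ∈ ℝ^N (entries nonnegative, summing to 1), any γ ∈ (0,1), and any α ≥ 1, the lower bound from the green-list sampling lemma is never vacuous: (γα/(1+(α-1)γ)) · S(p, (1-γ)(α-1)/(1+(α-1)γ)) ≥ γ, with strict inequality whenever α > 1 and p is not a point mass (i.e., p has at least two nonzero entries). -/

import Mathlib

open scoped BigOperators

/-- The spike entropy of a probability vector `p` with modulus `z`:
`S(p,z) = ∑ k, p k / (1 + z * p k)`. -/
noncomputable def spikeEntropy {N : ℕ} (p : Fin N → ℝ) (z : ℝ) : ℝ :=
  ∑ k, p k / (1 + z * p k)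

lemma div_one_add_le_div_one_add_mul {x z : ℝ} (hx0 : 0 ≤ x) (hx1 : x ≤ 1) (hz : 0 ≤ z) :
    x / (1 + z) ≤ x / (1 + z * x) :=
  div_le_div_of_nonneg_left hx0 (by positivity) (by nlinarith)

lemma div_one_add_lt_div_one_add_mul {x z : ℝ} (hx0 : 0 < x) (hx1 : x < 1) (hz : 0 < z) :
    x / (1 + z) < x / (1 + z * x) :=
  div_lt_div_of_pos_left hx0 (by positivity) (by nlinarith)

/-- A point mass minimizes the spike entropy. -/
lemma one_div_one_add_le_spikeEntropy {N : ℕ} {p : Fin N → ℝ} (hp0 : ∀ k, 0 ≤ p k)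
    (hp1 : ∑ k, p k = 1) {z : ℝ} (hz : 0 ≤ z) : 1 / (1 + z) ≤ spikeEntropy p z := by
  have hsum : 1 / (1 + z) = ∑ i, p i / (1 + z) := by rw [← Finset.sum_div, hp1]
  rw [hsum]
  refine Finset.sum_le_sum fun k _ => div_one_add_le_div_one_add_mul (hp0 k) ?_ hz
  rw [← hp1]
  exact Finset.single_le_sum (fun i _ => hp0 i) (Finset.mem_univ k)

/-- Only point masses minimize the spike entropy. -/
lemma one_div_one_add_lt_spikeEntropy {N : ℕ} {p : Fin N → ℝ} (hp0 : ∀ k, 0 ≤ p k)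
    (hp1 : ∑ k, p k = 1) {z : ℝ} (hz : 0 < z) {j k : Fin N} (hjk : j ≠ k) (hj : p j ≠ 0)
    (hk : p k ≠ 0) : 1 / (1 + z) < spikeEntropy p z := by
  have hj0 : 0 < p j := (hp0 j).lt_of_ne' hj
  have hk0 : 0 < p k := (hp0 k).lt_of_ne' hk
  have hj1 : p j < 1 := by
    rw [← hp1]
    exact Finset.single_lt_sum hjk.symm (Finset.mem_univ j) (Finset.mem_univ k) hk0
      fun i _ _ => hp0 i
  have hsum : 1 / (1 + z) = ∑ i, p i / (1 + z) := by rw [← Finset.sum_div, hp1]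
  rw [hsum]
  refine Finset.sum_lt_sum (fun i _ => div_one_add_le_div_one_add_mul (hp0 i) ?_ hz.le)
    ⟨j, Finset.mem_univ j, div_one_add_lt_div_one_add_mul hj0 hj1 hz⟩
  rw [← hp1]
  exact Finset.single_le_sum (fun i _ => hp0 i) (Finset.mem_univ i)

/-- The lower bound of the green-list sampling lemma is never vacuous: for any probability
vector `p`, `γ ∈ (0,1)` and `α ≥ 1`,
`(γα/(1+(α-1)γ)) · S(p, (1-γ)(α-1)/(1+(α-1)γ)) ≥ γ`, with strict inequality whenever `α > 1`
and `p` is not a point mass (i.e. has at least two nonzero entries). -/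
theorem green_bound_not_vacuous (N : ℕ) (p : Fin N → ℝ)
    (hp0 : ∀ k, 0 ≤ p k) (hp1 : ∑ k, p k = 1)
    (γ : ℝ) (hγ : γ ∈ Set.Ioo (0 : ℝ) 1) (α : ℝ) (hα : 1 ≤ α) :
    γ ≤ γ * α / (1 + (α - 1) * γ) *
        spikeEntropy p ((1 - γ) * (α - 1) / (1 + (α - 1) * γ)) ∧
      (1 < α → (∃ j k : Fin N, j ≠ k ∧ p j ≠ 0 ∧ p k ≠ 0) →
        γ < γ * α / (1 + (α - 1) * γ) *
          spikeEntropy p ((1 - γ) * (α - 1) / (1 + (α - 1) * γ))) := by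
  obtain ⟨hγ0, hγ1⟩ := hγ
  have hα' : 0 ≤ α - 1 := sub_nonneg.2 hα
  have hγ' : 0 < 1 - γ := sub_pos.2 hγ1
  have hD : 0 < 1 + (α - 1) * γ := by positivity
  set z := (1 - γ) * (α - 1) / (1 + (α - 1) * γ) with hz
  have hz0 : 0 ≤ z := by positivity
  have hcoef : γ * α / (1 + (α - 1) * γ) = γ * (1 + z) := by
    rw [hz]
    field_simp
    ring
  have hz1 : 0 < 1 + z := by positivity
  rw [hcoef, mul_assoc]
  refine ⟨le_mul_of_one_le_right hγ0.le ?_, fun hα1 ⟨j, k, hjk, hj, hk⟩ =>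
    lt_mul_of_one_lt_right hγ0 ?_⟩
  · rw [← div_le_iff₀' hz1]
    exact one_div_one_add_le_spikeEntropy hp0 hp1 hz0
  · rw [← div_lt_iff₀' hz1]
    exact one_div_one_add_lt_spikeEntropy hp0 hp1
      (div_pos (mul_pos hγ' (sub_pos.2 hα1)) hD) hjk hj hk
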